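/- There exists an infinite sequence {M_n}_{n∈ℕ} of 1dpda's having polynomial description size such that Pal = {w w^R : w ∈ {0,1}*} coincides with the μ-bounded intersection of {L(M_n)}_{n∈ℕ} for μ(n) = ⌈n/2⌉; that is, Pal = {x ∈ {0,1}* : x ∈ L(M_i) for all i ≤ ⌈|x|/2⌉}. -/

import Mathlib

/-!
Formalization of one-way deterministic pushdown automata (1dpda) following
Yamakami, "Intersection and Union Hierarchies of Deterministic Context-Free
Languages and Pumping Lemmas".
-/

namespace DCFLFormal

/-- Tape symbols: the left endmarker ¢, the right endmarker $, and input symbols. -/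
inductive TSym (α : Type) : Type
  | lend : TSym α
  | rend : TSym α
  | ch : α → TSym α

/-- A one-way deterministic pushdown automaton (1dpda).  `δ q (some t) a` is the
transition reading the tape symbol `t` with top stack symbol `a`; `δ q none a`
is the ε-transition.  The value `some (p, w)` means: change state to `p` and
replace the topmost stack symbol by the string `w`. -/
structure DPDA (Q α Γ : Type) where
  δ : Q → Option (TSym α) → Γ → Option (Q × List Γ)
  q0 : Q
  Z0 : Γ
  Acc : Set Q
  Rej : Set Q

/-- A configuration: current state, remaining (unread) tape, and stack content
(topmost symbol first, the bottom marker last). -/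
structure Cfg (Q α Γ : Type) where
  st : Q
  inp : List (TSym α)
  stk : List Γ

namespace DPDA

variable {Q α Γ : Type}

/-- Halting (accepting or rejecting) states. -/
def IsHalting (M : DPDA Q α Γ) (q : Q) : Prop := q ∈ M.Acc ∨ q ∈ M.Rej

/-- One step of the machine: an ε-move if one is defined, otherwise read the
next tape symbol; the head moves right exactly when a tape symbol is read. -/
def step (M : DPDA Q α Γ) (c : Cfg Q α Γ) : Option (Cfg Q α Γ) :=
  match c.stk with
  | [] => none
  | a :: s =>
    match M.δ c.st none a with
    | some (p, w) => some ⟨p, c.inp, w ++ s⟩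
    | none =>
      match c.inp with
      | [] => none
      | t :: rest =>
        match M.δ c.st (some t) a with
        | some (p, w) => some ⟨p, rest, w ++ s⟩
        | none => none

/-- Iterated steps. -/
def stepN (M : DPDA Q α Γ) : ℕ → Cfg Q α Γ → Option (Cfg Q α Γ)
  | 0, c => some c
  | n + 1, c => (M.step c).bind (M.stepN n)

/-- The tape holding ¢ x $. -/
def tape (x : List α) : List (TSym α) :=
  TSym.lend :: x.map TSym.ch ++ [TSym.rend]

/-- The initial configuration on input `x`. -/
def init (M : DPDA Q α Γ) (x : List α) : Cfg Q α Γ := ⟨M.q0, tape x, [M.Z0]⟩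

/-- `M` accepts `x`: the computation reaches an accepting state. -/
def Accepts (M : DPDA Q α Γ) (x : List α) : Prop :=
  ∃ n c, M.stepN n (M.init x) = some c ∧ c.st ∈ M.Acc

/-- `M` rejects `x`: the computation reaches a rejecting state. -/
def Rejects (M : DPDA Q α Γ) (x : List α) : Prop :=
  ∃ n c, M.stepN n (M.init x) = some c ∧ c.st ∈ M.Rej

/-- `M` halts (in an accepting or rejecting state) on every input. -/
def HaltsOnAll (M : DPDA Q α Γ) : Prop :=
  ∀ x : List α, ∃ n c, M.stepN n (M.init x) = some c ∧ M.IsHalting c.st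

/-- The language recognized by `M`. -/
def lang (M : DPDA Q α Γ) : Set (List α) := {x | M.Accepts x}

/-- Well-formedness of a 1dpda: accepting and rejecting states are disjoint,
halting states have no outgoing transitions, for every non-halting state,
stack symbol and (non-empty) tape symbol exactly one of the symbol- and the
ε-transition is defined, and the bottom marker Z₀ is never removed. -/
def Valid (M : DPDA Q α Γ) : Prop :=
  (∀ q, q ∈ M.Acc → q ∉ M.Rej) ∧
  (∀ q, M.IsHalting q → ∀ σ a, M.δ q σ a = none) ∧
  (∀ q, ¬ M.IsHalting q → ∀ σ a, ((M.δ q (some σ) a).isSome ↔ M.δ q none a = none)) ∧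
  (∀ q σ p w, M.δ q σ M.Z0 = some (p, w) → w ≠ [])

end DPDA

/-- A language is deterministic context-free if it is recognized by some 1dpda
(with finitely many states and stack symbols) that halts on all inputs. -/
def IsDCFL {α : Type} (L : Set (List α)) : Prop :=
  ∃ (Q Γ : Type) (_ : Fintype Q) (_ : Fintype Γ) (M : DPDA Q α Γ),
    M.Valid ∧ M.HaltsOnAll ∧ L = M.lang

/-- `DCFL(d)`: intersections of `d` dcf languages. -/
def DCFLInter {α : Type} (d : ℕ) (L : Set (List α)) : Prop :=
  ∃ f : Fin d → Set (List α), (∀ i, IsDCFL (f i)) ∧ L = ⋂ i, f i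

/-- `DCFL[d]`: unions of `d` dcf languages. -/
def DCFLUnion {α : Type} (d : ℕ) (L : Set (List α)) : Prop :=
  ∃ f : Fin d → Set (List α), (∀ i, IsDCFL (f i)) ∧ L = ⋃ i, f i

/-- `rep x i` is the string `x` repeated `i` times. -/
def rep {α : Type} (x : List α) (i : ℕ) : List α := (List.replicate i x).flatten

/-- `(x, y)` is an iterative pair of the string `u ++ x ++ v ++ y ++ z` for `L`. -/
def IterPair {α : Type} (L : Set (List α)) (u x v y z : List α) : Prop :=
  1 ≤ (x ++ y).length ∧ ∀ i : ℕ, u ++ rep x i ++ v ++ rep y i ++ z ∈ L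

/-- A nondegenerate iterative pair: either `{u xⁱ v yʲ z ∈ L : j ≥ 0}` is finite
for each `i`, or `{u xⁱ v yʲ z ∈ L : i ≥ 0}` is finite for each `j`. -/
def NonDegIterPair {α : Type} (L : Set (List α)) (u x v y z : List α) : Prop :=
  IterPair L u x v y z ∧
  ((∀ i : ℕ, {s | s ∈ L ∧ ∃ j : ℕ, s = u ++ rep x i ++ v ++ rep y j ++ z}.Finite) ∨
   (∀ j : ℕ, {s | s ∈ L ∧ ∃ i : ℕ, s = u ++ rep x i ++ v ++ rep y j ++ z}.Finite))


/-- The push size of `M` is at most `e`: every string pushed by a single move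
has length at most `e`. -/
def PushSizeLE {Q α Γ : Type} (M : DPDA Q α Γ) (e : ℕ) : Prop :=
  ∀ q σ a r, M.δ q σ a = some r → r.2.length ≤ e

/-- The language of even-length palindromes over `{0,1}`. -/
def Pal : Set (List Bool) := {s | ∃ w : List Bool, s = w ++ w.reverse}

namespace DPDA

variable {Q α Γ : Type}

theorem step_eq_none_of_isHalting {M : DPDA Q α Γ} (hM : M.Valid) {c : Cfg Q α Γ}
    (hc : M.IsHalting c.st) : M.step c = none := by
  have h := hM.2.1 c.st hc
  unfold step
  rcases c.stk with _ | ⟨a, s⟩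
  · rfl
  · rcases c.inp with _ | ⟨t, r⟩ <;> simp [h]

/-- The configurations without successor reachable from a given one are all equal. -/
theorem stepN_unique (M : DPDA Q α Γ) {m m' : ℕ} {c d d' : Cfg Q α Γ}
    (h : M.stepN m c = some d) (hd : M.step d = none)
    (h' : M.stepN m' c = some d') (hd' : M.step d' = none) : d = d' := by
  induction m generalizing m' c with
  | zero =>
    cases m' with
    | zero => simp_all [stepN]
    | succ m' => simp_all [stepN]
  | succ m ih =>
    cases m' with
    | zero => simp_all [stepN]
    | succ m' =>
      rw [stepN, Option.bind_eq_some_iff] at h h'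
      obtain ⟨e, he, h⟩ := h
      obtain ⟨e', he', h'⟩ := h'
      obtain rfl : e = e' := by simpa [he] using he'
      exact ih h h'

/-- From configuration `c` the computation of `M` reaches state `q`. -/
def Reaches (M : DPDA Q α Γ) (c : Cfg Q α Γ) (q : Q) : Prop :=
  ∃ m d, M.stepN m c = some d ∧ d.st = q

theorem Reaches.of_step {M : DPDA Q α Γ} {c d : Cfg Q α Γ} {q : Q}
    (h : M.step c = some d) (hd : M.Reaches d q) : M.Reaches c q := by
  obtain ⟨m, e, he, hq⟩ := hd
  exact ⟨m + 1, e, by simp [stepN, h, he], hq⟩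

theorem Reaches.accepts_iff {M : DPDA Q α Γ} (hM : M.Valid) {x : List α} {q : Q}
    (h : M.Reaches (M.init x) q) (hq : M.IsHalting q) : M.Accepts x ↔ q ∈ M.Acc := by
  obtain ⟨m, d, hd, rfl⟩ := h
  refine ⟨fun ⟨m', d', hd', hacc⟩ => ?_, fun hacc => ⟨m, d, hd, hacc⟩⟩
  rwa [M.stepN_unique hd (step_eq_none_of_isHalting hM hq) hd'
    (step_eq_none_of_isHalting hM (Or.inl hacc))]

end DPDA

/-- States of the machine comparing the `n`-th symbols from both ends: a verdict; the reading
phase, with a counter capped at `n + 1`, the `n`-th symbol once seen, and whether the number of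
symbols read is odd; the popping phase, with the number of symbols still to be skipped and the
symbol to compare with. -/
abbrev MirrorState (n : ℕ) : Type :=
  Bool ⊕ (Fin (n + 2) × Bool × Bool) ⊕ (Fin (n + 1) × Bool)

/-- Transition function of `mirrorDPDA`. -/
def mirrorStep (n : ℕ) :
    MirrorState n → Option (TSym Bool) → Option Bool → Option (MirrorState n × List (Option Bool))
  | .inl _, _, _ => none
  | .inr (.inl _), none, _ => none
  | .inr (.inl s), some .lend, a => some (.inr (.inl s), [a])
  | .inr (.inl (k, b, p)), some (.ch c), a =>
    some (.inr (.inl (⟨min (k + 1) (n + 1), by omega⟩, if k.val = n then c else b, !p)),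
      [some c, a])
  | .inr (.inl (_, b, p)), some .rend, a =>
    some (if p then .inl false else .inr (.inr (Fin.last n, b)), [a])
  | .inr (.inr _), some _, _ => none
  | .inr (.inr (_, b)), none, none => some (.inl (false == b), [none])
  | .inr (.inr (k, b)), none, some c =>
    some (if k.val = 0 then .inl (c == b) else .inr (.inr (⟨k - 1, by omega⟩, b)), [])

/-- The 1dpda accepting the words of even length whose `n`-th symbols (counted from zero) from
the left and from the right agree, if they exist: it stores its input on the stack, remembering
the `n`-th symbol, and at the right endmarker pops `n` symbols and compares. -/
def mirrorDPDA (n : ℕ) : DPDA (MirrorState n) Bool (Option Bool) where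
  δ := mirrorStep n
  q0 := .inr (.inl (0, false, false))
  Z0 := none
  Acc := {.inl true}
  Rej := {.inl false}

theorem mirrorDPDA_isHalting_iff {n : ℕ} {q : MirrorState n} :
    (mirrorDPDA n).IsHalting q ↔ ∃ b, q = .inl b := by
  simp [DPDA.IsHalting, mirrorDPDA, or_comm]

theorem mirrorDPDA_valid (n : ℕ) : (mirrorDPDA n).Valid := by
  refine ⟨?_, ?_, ?_, ?_⟩
  · rintro q rfl h
    simp [mirrorDPDA] at h
  · intro q hq σ a
    obtain ⟨b, rfl⟩ := mirrorDPDA_isHalting_iff.1 hq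
    rfl
  · rintro (b | ⟨k, b, p⟩ | ⟨k, b⟩) hq σ a
    · exact absurd (mirrorDPDA_isHalting_iff.2 ⟨b, rfl⟩) hq
    · cases σ <;> simp [mirrorDPDA, mirrorStep]
    · cases a <;> simp [mirrorDPDA, mirrorStep]
  · rintro (b | ⟨k, b, p⟩ | ⟨k, b⟩) (_ | _ | _ | c) p w h <;>
      simp [mirrorDPDA, mirrorStep] at h <;> simp [← h.2]

theorem mirrorDPDA_pushSizeLE (n : ℕ) : PushSizeLE (mirrorDPDA n) 2 := by
  rintro (b | ⟨k, b, p⟩ | ⟨k, b⟩) (_ | _ | _ | c) (_ | a) r h <;>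
    simp [mirrorDPDA, mirrorStep] at h <;> simp [← h]

theorem mirrorDPDA_reaches_of_pop (n : ℕ) (b : Bool) (s : List Bool) (k : Fin (n + 1)) :
    (mirrorDPDA n).Reaches ⟨.inr (.inr (k, b)), [], s.map some ++ [none]⟩
      (.inl (s.getD k false == b)) := by
  induction s generalizing k with
  | nil => exact ⟨1, ⟨_, [], [none]⟩, rfl, by simp⟩
  | cons c s ih =>
    by_cases hk : k.val = 0
    · refine ⟨1, ⟨.inl (c == b), [], s.map some ++ [none]⟩, ?_, by simp [hk]⟩
      simp [DPDA.stepN, DPDA.step, mirrorDPDA, mirrorStep, hk]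
    · obtain ⟨j, hj⟩ := Nat.exists_eq_succ_of_ne_zero hk
      have h := ih ⟨k - 1, by omega⟩
      refine DPDA.Reaches.of_step (d := ⟨.inr (.inr (⟨k - 1, by omega⟩, b)), [],
        s.map some ++ [none]⟩) ?_ ?_
      · simp [DPDA.step, mirrorDPDA, mirrorStep, hk]
      · simpa [hj] using h

/-- Membership test carried out by `mirrorDPDA n`. -/
def mirrorTest (n : ℕ) (x : List Bool) : Bool :=
  decide (Even x.length) && (x.reverse.getD n false == x.getD n false)

theorem mirrorDPDA_reaches_of_read (n : ℕ) (v u : List Bool) :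
    (mirrorDPDA n).Reaches
      ⟨.inr (.inl (⟨min u.length (n + 1), by omega⟩, u.getD n false, !decide (Even u.length))),
        v.map TSym.ch ++ [TSym.rend], u.reverse.map some ++ [none]⟩
      (.inl (mirrorTest n (u ++ v))) := by
  induction v generalizing u with
  | nil =>
    obtain ⟨a, s, hs⟩ : ∃ a s, u.reverse.map some ++ [none] = a :: s :=
      List.exists_cons_of_ne_nil (by simp)
    by_cases hu : Even u.length
    · refine DPDA.Reaches.of_step (d := ⟨.inr (.inr (Fin.last n, u.getD n false)), [],
        u.reverse.map some ++ [none]⟩) ?_ ?_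
      · rw [hs]
        simp [DPDA.step, mirrorDPDA, mirrorStep, hu]
      · simpa [mirrorTest, hu] using
          mirrorDPDA_reaches_of_pop n (u.getD n false) u.reverse (Fin.last n)
    · refine ⟨1, ⟨.inl false, [], u.reverse.map some ++ [none]⟩, ?_, by simp [mirrorTest, hu]⟩
      rw [hs]
      simp [DPDA.stepN, DPDA.step, mirrorDPDA, mirrorStep, hu]
  | cons c v ih =>
    have h := ih (u ++ [c])
    rw [List.append_assoc, List.singleton_append] at h
    refine DPDA.Reaches.of_step ?_ h
    obtain ⟨a, s, hs⟩ : ∃ a s, u.reverse.map some ++ [none] = a :: s :=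
      List.exists_cons_of_ne_nil (by simp)
    have hcount : min (min u.length (n + 1) + 1) (n + 1) = min (u.length + 1) (n + 1) := by omega
    have hbit : (if min u.length (n + 1) = n then c else u.getD n false) =
        (u ++ [c]).getD n false := by
      rcases lt_trichotomy u.length n with hn | hn | hn
      · rw [if_neg (by omega), List.getD_eq_default _ _ (by omega),
          List.getD_eq_default _ _ (by simp; omega)]
      · rw [if_pos (by omega)]
        simp [← hn]
      · rw [if_neg (by omega), List.getD_append _ _ _ _ hn]
    rw [List.reverse_append, List.reverse_singleton, List.singleton_append, List.map_cons,
      List.cons_append, hs, ← hbit]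
    rw [List.map_reverse] at hs
    simp [DPDA.step, mirrorDPDA, mirrorStep, hcount, hs, Nat.even_add_one,
      -Nat.not_even_iff_odd]

theorem mirrorDPDA_reaches_init (n : ℕ) (x : List Bool) :
    (mirrorDPDA n).Reaches ((mirrorDPDA n).init x) (.inl (mirrorTest n x)) :=
  DPDA.Reaches.of_step (by simp [DPDA.step, DPDA.init, DPDA.tape, mirrorDPDA, mirrorStep])
    (mirrorDPDA_reaches_of_read n x [])

theorem mirrorDPDA_haltsOnAll (n : ℕ) : (mirrorDPDA n).HaltsOnAll := fun x =>
  let ⟨m, d, hd, hq⟩ := mirrorDPDA_reaches_init n x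
  ⟨m, d, hd, mirrorDPDA_isHalting_iff.2 ⟨_, hq⟩⟩

theorem mirrorDPDA_accepts_iff (n : ℕ) (x : List Bool) :
    (mirrorDPDA n).Accepts x ↔
      Even x.length ∧ x.reverse.getD n false = x.getD n false := by
  rw [(mirrorDPDA_reaches_init n x).accepts_iff (mirrorDPDA_valid n)
    (mirrorDPDA_isHalting_iff.2 ⟨_, rfl⟩)]
  simp [mirrorDPDA, mirrorTest]

theorem mem_Pal_iff (x : List Bool) : x ∈ Pal ↔ Even x.length ∧ x.reverse = x := by
  constructor
  · rintro ⟨w, rfl⟩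
    simp
  · rintro ⟨⟨m, hm⟩, hx⟩
    refine ⟨x.take m, ?_⟩
    rw [List.reverse_take, hx, hm, Nat.add_sub_cancel, List.take_append_drop]

theorem reverse_eq_self_iff_getD (x : List Bool) :
    x.reverse = x ↔
      ∀ i : ℕ, i ≤ (x.length + 1) / 2 → x.reverse.getD i false = x.getD i false := by
  refine ⟨fun h i _ => by rw [h], fun h => List.ext_getElem (by simp) fun i hi hi' => ?_⟩
  rcases le_total i ((x.length + 1) / 2) with hle | hle
  · simpa [hi'] using h i hle
  · have hj := h (x.length - 1 - i) (by omega)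
    have hlt : x.length - 1 - i < x.length := by omega
    have hinv : x.length - 1 - (x.length - 1 - i) = i := by omega
    simp [hlt, hinv] at hj
    simp [hj]

/-- There is a sequence `{Mₙ}` of 1dpda's of polynomial description size
(`des(M) = |Q|·|Σ|·|Γ^{≤e}|` with `e` the push size) whose `μ`-bounded
intersection for `μ(n) = ⌈n/2⌉` is exactly `Pal`. -/
theorem Pal_eq_mu_bounded_intersection :
    ∃ (Q Γ : ℕ → Type) (_ : ∀ n, Fintype (Q n)) (_ : ∀ n, Fintype (Γ n))
      (M : ∀ n : ℕ, DPDA (Q n) Bool (Γ n)),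
      (∀ n, (M n).Valid ∧ (M n).HaltsOnAll) ∧
      (∃ p : Polynomial ℕ, ∀ n : ℕ, ∃ e : ℕ, PushSizeLE (M n) e ∧
        Fintype.card (Q n) * Fintype.card Bool *
          (Finset.range (e + 1)).sum (fun i => Fintype.card (Γ n) ^ i) ≤
            Polynomial.eval n p) ∧
      (∀ x : List Bool,
        x ∈ Pal ↔ ∀ i : ℕ, i ≤ (x.length + 1) / 2 → (M i).Accepts x) := by
  refine ⟨MirrorState, fun _ => Option Bool, fun _ => inferInstance, fun _ => inferInstance,
    mirrorDPDA, fun n => ⟨mirrorDPDA_valid n, mirrorDPDA_haltsOnAll n⟩,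
    ⟨Polynomial.C 156 * Polynomial.X + Polynomial.C 312, fun n =>
      ⟨2, mirrorDPDA_pushSizeLE n, ?_⟩⟩, fun x => ?_⟩
  · simp [Finset.sum_range_succ]
    omega
  · simp only [mirrorDPDA_accepts_iff, mem_Pal_iff, reverse_eq_self_iff_getD]
    exact ⟨fun h i hi => ⟨h.1, h.2 i hi⟩,
      fun h => ⟨(h 0 (Nat.zero_le _)).1, fun i hi => (h i hi).2⟩⟩

end DCFLFormal
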